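/- arXiv:2208.01541 — 11 statements merged into one kernel-verified Lean document; each statement's English description precedes it below -/
import Mathlib

section
/- For a function f : X → ℝ ∪ {−∞, +∞} on a real normed space X, the following are equivalent: (i) f is LĈ-convex; (ii) f is lower semicontinuous and there exists a Lipschitz continuous function g : X → ℝ with g(x) ≤ f(x) for all x ∈ X. -/
/-- The cone `y ↦ r - K * ‖y - x‖` is concave. -/
theorem concaveOn_const_sub_mul_norm_sub {X : Type*} [NormedAddCommGroup X] [NormedSpace ℝ X]
    (x : X) (r : ℝ) {K : ℝ} (hK : 0 ≤ K) :
    ConcaveOn ℝ Set.univ fun y : X => r - K * ‖y - x‖ := by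
  have hdist : ConvexOn ℝ Set.univ fun y : X => ‖y - x‖ := by
    simpa only [dist_eq_norm] using convexOn_univ_dist x
  exact (concaveOn_const r convex_univ).sub (hdist.smul hK)

/-- The cone `y ↦ r - K * ‖y - x‖` is `K`-Lipschitz. -/
theorem abs_const_sub_mul_norm_sub_sub_le {X : Type*} [NormedAddCommGroup X]
    (x : X) (r : ℝ) {K : ℝ} (hK : 0 ≤ K) (y z : X) :
    |(r - K * ‖y - x‖) - (r - K * ‖z - x‖)| ≤ K * ‖y - z‖ := by
  have hnorm : |‖z - x‖ - ‖y - x‖| ≤ ‖y - z‖ := by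
    simpa [norm_sub_rev z y] using abs_norm_sub_norm_le (z - x) (y - x)
  calc |(r - K * ‖y - x‖) - (r - K * ‖z - x‖)| = K * |‖z - x‖ - ‖y - x‖| := by
        rw [← abs_of_nonneg hK, ← abs_mul, abs_of_nonneg hK]
        ring_nf
    _ ≤ K * ‖y - z‖ := mul_le_mul_of_nonneg_left hnorm hK

/-- A lower semicontinuous function with a Lipschitz minorant admits, below each of its values
`f x`, a minorizing cone with apex at `x`. -/
theorem LowerSemicontinuousAt.exists_cone_le {X : Type*} [NormedAddCommGroup X] {f : X → EReal}
    {x : X} (hf : LowerSemicontinuousAt f x) {g : X → ℝ} {k : ℝ} (hk : 0 ≤ k)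
    (hg : ∀ x y : X, |g x - g y| ≤ k * ‖x - y‖) (hgf : ∀ x, (g x : EReal) ≤ f x)
    {r : ℝ} (hr : (r : EReal) < f x) :
    ∃ K : ℝ, 0 ≤ K ∧ ∀ y, ((r - K * ‖y - x‖ : ℝ) : EReal) ≤ f y := by
  obtain ⟨δ, hδ, hball⟩ := Metric.eventually_nhds_iff.1 (hf r hr)
  have hK : 0 ≤ k + |r - g x| / δ := by positivity
  refine ⟨k + |r - g x| / δ, hK, fun y => ?_⟩
  rcases lt_or_ge (dist y x) δ with hy | hy
  · refine le_trans ?_ (hball hy).le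
    exact EReal.coe_le_coe_iff.2 (sub_le_self _ (mul_nonneg hK (norm_nonneg _)))
  · refine le_trans (EReal.coe_le_coe_iff.2 ?_) (hgf y)
    rw [dist_eq_norm] at hy
    have hfar : |r - g x| ≤ |r - g x| / δ * ‖y - x‖ := by
      rw [div_mul_eq_mul_div, le_div_iff₀ hδ]
      exact mul_le_mul_of_nonneg_left hy (abs_nonneg _)
    have hlip := (abs_le.1 (hg y x)).1
    have hgap := le_abs_self (r - g x)
    rw [add_mul]
    linarith

/-- A function `f : X → ℝ ∪ {−∞, +∞}` on a real normed space is `LĈ`-convex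
iff it is lower semicontinuous and bounded from below by a Lipschitz continuous
real-valued function. -/
theorem statement3 {X : Type*} [NormedAddCommGroup X] [NormedSpace ℝ X]
    (f : X → EReal)
    (S : Set (X → ℝ))
    (hS : S = {h : X → ℝ | (ConcaveOn ℝ Set.univ h ∧
        ∃ k : ℝ, 0 ≤ k ∧ ∀ x y : X, |h x - h y| ≤ k * ‖x - y‖) ∧
        ∀ x, (h x : EReal) ≤ f x}) :
    (S.Nonempty ∧ ∀ x, f x = ⨆ h ∈ S, ((h x : ℝ) : EReal)) ↔
    (LowerSemicontinuous f ∧ ∃ g : X → ℝ,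
      (∃ k : ℝ, 0 ≤ k ∧ ∀ x y : X, |g x - g y| ≤ k * ‖x - y‖) ∧
      ∀ x, (g x : EReal) ≤ f x) := by
  subst hS
  constructor
  · rintro ⟨⟨g, ⟨-, hg⟩, hgf⟩, hsup⟩
    refine ⟨?_, g, hg, hgf⟩
    rw [funext hsup]
    refine lowerSemicontinuous_biSup fun h hh => Continuous.lowerSemicontinuous ?_
    obtain ⟨⟨-, k, -, hlip⟩, -⟩ := hh
    exact continuous_coe_real_ereal.comp (LipschitzWith.of_dist_le' (K := k) fun x y => by
      simpa only [dist_eq_norm, Real.norm_eq_abs] using hlip x y).continuous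
  · rintro ⟨hf, g, ⟨k, hk, hg⟩, hgf⟩
    constructor
    · refine ⟨fun y => g 0 - k * ‖y - 0‖, ⟨concaveOn_const_sub_mul_norm_sub 0 _ hk, k, hk,
        abs_const_sub_mul_norm_sub_sub_le 0 _ hk⟩, fun y => le_trans ?_ (hgf y)⟩
      have hlip := (abs_le.1 (hg y 0)).1
      exact EReal.coe_le_coe_iff.2 (by linarith)
    · refine fun x => le_antisymm (le_of_forall_lt fun c hc => ?_) (iSup₂_le fun h hh => hh.2 x)
      obtain ⟨r, hcr, hr⟩ := EReal.lt_iff_exists_real_btwn.1 hc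
      obtain ⟨K, hK, hKf⟩ := LowerSemicontinuousAt.exists_cone_le (hf x) hk hg hgf hr
      refine hcr.trans_le ?_
      refine le_iSup₂_of_le (fun y => r - K * ‖y - x‖)
        ⟨⟨concaveOn_const_sub_mul_norm_sub x r hK, K, hK,
          abs_const_sub_mul_norm_sub_sub_le x r hK⟩, hKf⟩ ?_
      simp
end

section
/- Let X be a real normed space and let f : X → ℝ ∪ {−∞, +∞} be LĈ-convex with dom f ≠ ∅ (f is finite at some point). Then f is regularly LĈ-convex, i.e. the set S⁻max(LĈ, f) of maximal LĈ-minorants of f is nonempty and f(x) = sup{h(x) : h ∈ S⁻max(LĈ, f)} for every x ∈ X. -/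
/-- A concave function on the whole space that is minorized by `c - k * ‖x‖` is Lipschitz
with constant `k`. -/
theorem ConcaveOn.abs_sub_le_of_sub_norm_le {X : Type*} [NormedAddCommGroup X] [NormedSpace ℝ X]
    {g : X → ℝ} (hg : ConcaveOn ℝ Set.univ g) {c k : ℝ} (hk : 0 ≤ k)
    (hc : ∀ x, c - k * ‖x‖ ≤ g x) (x y : X) : |g x - g y| ≤ k * ‖x - y‖ := by
  have key : ∀ x y : X, g x - g y ≤ k * ‖x - y‖ := by
    intro x y
    have hline : ∀ t : ℝ, 1 ≤ t →
        c - g x - k * ‖x‖ ≤ t * (g y - g x + k * ‖x - y‖) := by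
      intro t ht
      have ht0 : 0 < t := by linarith
      have hconc := hg.2 (Set.mem_univ x) (Set.mem_univ (x + t • (y - x)))
        (sub_nonneg.2 (inv_le_one_of_one_le₀ ht)) (inv_nonneg.2 ht0.le) (sub_add_cancel 1 t⁻¹)
      have hpt : (1 - t⁻¹) • x + t⁻¹ • (x + t • (y - x)) = y := by
        rw [smul_add, smul_smul, inv_mul_cancel₀ ht0.ne', sub_smul, one_smul, one_smul]
        abel
      rw [hpt, smul_eq_mul, smul_eq_mul] at hconc
      have hscaled : (t - 1) * g x + g (x + t • (y - x)) ≤ t * g y := by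
        have := mul_le_mul_of_nonneg_left hconc ht0.le
        have heq : t * ((1 - t⁻¹) * g x + t⁻¹ * g (x + t • (y - x))) =
            (t - 1) * g x + g (x + t • (y - x)) := by
          field_simp
        linarith
      have hnorm : ‖x + t • (y - x)‖ ≤ ‖x‖ + t * ‖x - y‖ := by
        refine (norm_add_le _ _).trans_eq ?_
        rw [norm_smul, Real.norm_of_nonneg ht0.le, norm_sub_rev]
      have := mul_le_mul_of_nonneg_left hnorm hk
      have := hc (x + t • (y - x))
      nlinarith
    by_contra! hlt
    set a := g y - g x + k * ‖x - y‖
    have ha0 : a < 0 := by linarith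
    set b := c - g x - k * ‖x‖
    have h := hline (1 + |b| / (-a)) (by
      have : 0 ≤ |b| / (-a) := div_nonneg (abs_nonneg _) (by linarith)
      linarith)
    have hmul : (1 + |b| / (-a)) * a = a - |b| := by
      rw [add_mul, one_mul, div_neg, neg_mul, div_mul_cancel₀ _ ha0.ne, sub_eq_add_neg]
    rw [hmul] at h
    linarith [neg_abs_le b]
  rw [abs_le]
  have := key y x
  rw [norm_sub_rev] at this
  constructor <;> linarith [key x y]

/-- The pointwise supremum of a nonempty, pointwise bounded chain of concave functions is
concave. -/
theorem IsChain.concaveOn_iSup {X : Type*} [AddCommGroup X] [Module ℝ X]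
    {c : Set (X → ℝ)} (hchain : IsChain (· ≤ ·) c) (hne : c.Nonempty)
    (hconc : ∀ z ∈ c, ConcaveOn ℝ Set.univ z)
    (hbdd : ∀ x, BddAbove (Set.range fun z : c => z.1 x)) :
    ConcaveOn ℝ Set.univ fun x => ⨆ z : c, z.1 x := by
  have : Nonempty c := hne.to_subtype
  refine ⟨convex_univ, fun x _ y _ a b ha hb hab => ?_⟩
  refine le_of_forall_pos_le_add fun ε hε => ?_
  obtain ⟨z, hz⟩ := exists_lt_of_lt_ciSup (sub_lt_self (⨆ z : c, z.1 x) hε)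
  obtain ⟨w, hw⟩ := exists_lt_of_lt_ciSup (sub_lt_self (⨆ z : c, z.1 y) hε)
  obtain ⟨v, hzv, hwv⟩ : ∃ v : c, z.1 ≤ v.1 ∧ w.1 ≤ v.1 := by
    rcases hchain.total z.2 w.2 with h | h
    · exact ⟨w, h, le_rfl⟩
    · exact ⟨z, le_rfl, h⟩
  have hv := (hconc v v.2).2 (Set.mem_univ x) (Set.mem_univ y) ha hb hab
  have hvG := le_ciSup (hbdd (a • x + b • y)) v
  simp only [smul_eq_mul] at hv ⊢
  have hx := mul_le_mul_of_nonneg_left (hz.le.trans (hzv x)) ha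
  have hy := mul_le_mul_of_nonneg_left (hw.le.trans (hwv y)) hb
  have : a * ε + b * ε = ε := by rw [← add_mul, hab, one_mul]
  linarith

/-- An `LĈ`-convex function `f : X → ℝ ∪ {−∞, +∞}` with nonempty effective
domain is regularly `LĈ`-convex: the set of maximal `LĈ`-minorants of `f` is nonempty and
`f` is its upper envelope. -/
theorem statement4 {X : Type*} [NormedAddCommGroup X] [NormedSpace ℝ X]
    (f : X → EReal)
    (S : Set (X → ℝ))
    (hS : S = {h : X → ℝ | (ConcaveOn ℝ Set.univ h ∧
        ∃ k : ℝ, 0 ≤ k ∧ ∀ x y : X, |h x - h y| ≤ k * ‖x - y‖) ∧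
        ∀ x, (h x : EReal) ≤ f x})
    (M : Set (X → ℝ)) (hM : M = {h ∈ S | ∀ g ∈ S, h ≤ g → g = h})
    (hconv : S.Nonempty ∧ ∀ x, f x = ⨆ h ∈ S, ((h x : ℝ) : EReal))
    (hdom : ∃ x, f x ≠ ⊤ ∧ f x ≠ ⊥) :
    M.Nonempty ∧ ∀ x, f x = ⨆ h ∈ M, ((h x : ℝ) : EReal) := by
  have hchains : ∀ c ⊆ S, IsChain (· ≤ ·) c → ∀ y ∈ c, ∃ ub ∈ S, ∀ z ∈ c, z ≤ ub := by
    intro c hcS hchain y hy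
    have hyS := hcS hy
    rw [hS] at hyS
    obtain ⟨⟨-, k, hk, hyk⟩, hyf⟩ := hyS
    -- Members of the chain above `y` inherit its Lipschitz constant.
    set d : Set (X → ℝ) := {z ∈ c | y ≤ z}
    have hyd : y ∈ d := ⟨hy, le_rfl⟩
    have : Nonempty d := ⟨⟨y, hyd⟩⟩
    have hdS : ∀ z ∈ d, ConcaveOn ℝ Set.univ z ∧ ∀ x, (z x : EReal) ≤ f x := by
      intro z hz
      have := hcS hz.1
      rw [hS] at this
      exact ⟨this.1.1, this.2⟩
    have hlip : ∀ z ∈ d, ∀ a b, z a ≤ z b + k * ‖a - b‖ := by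
      intro z hz a b
      have := (hdS z hz).1.abs_sub_le_of_sub_norm_le (c := y 0) hk (fun x => by
        have h := (abs_le.1 (hyk x 0)).1
        rw [sub_zero] at h
        linarith [hz.2 x]) a b
      linarith [le_abs_self (z a - z b)]
    obtain ⟨x₀, htop, hbot⟩ := hdom
    have hbdd : ∀ x, BddAbove (Set.range fun z : d => z.1 x) := by
      intro x
      refine ⟨(f x₀).toReal + k * ‖x - x₀‖, ?_⟩
      rintro _ ⟨z, rfl⟩
      have h := (hdS z z.2).2 x₀
      rw [← EReal.coe_toReal htop hbot, EReal.coe_le_coe_iff] at h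
      linarith [hlip z z.2 x x₀]
    have hle : ∀ z ∈ d, z ≤ fun x => ⨆ z : d, z.1 x :=
      fun z hz x => le_ciSup (hbdd x) ⟨z, hz⟩
    have hsupLip : ∀ a b, (⨆ z : d, z.1 a) - (⨆ z : d, z.1 b) ≤ k * ‖a - b‖ := by
      intro a b
      rw [sub_le_iff_le_add']
      exact ciSup_le fun z => (hlip z z.2 a b).trans (by gcongr; exact hle z z.2 b)
    refine ⟨fun x => ⨆ z : d, z.1 x, ?_, ?_⟩
    · rw [hS]
      refine ⟨⟨(hchain.mono fun z hz => hz.1).concaveOn_iSup ⟨y, hyd⟩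
        (fun z hz => (hdS z hz).1) hbdd, k, hk, fun a b => ?_⟩, fun x => ?_⟩
      · exact abs_sub_le_iff.2 ⟨hsupLip a b, by rw [norm_sub_rev]; exact hsupLip b a⟩
      · by_cases hx : f x = ⊤
        · rw [hx]
          exact le_top
        · have hx' : f x ≠ ⊥ := fun h => by simpa [h] using hyf x
          rw [← EReal.coe_toReal hx hx', EReal.coe_le_coe_iff]
          refine ciSup_le fun z => ?_
          rw [← EReal.coe_le_coe_iff, EReal.coe_toReal hx hx']
          exact (hdS z z.2).2 x
    · intro z hz
      rcases hchain.total hz hy with h | h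
      · exact h.trans (hle y hyd)
      · exact hle z ⟨hz, h⟩
  have hmax : ∀ h ∈ S, ∃ m ∈ M, h ≤ m := by
    intro h hh
    obtain ⟨m, hhm, hm⟩ := zorn_le_nonempty₀ S hchains h hh
    refine ⟨m, ?_, hhm⟩
    rw [hM]
    exact ⟨hm.1, fun g hg hmg => le_antisymm (hm.2 hg hmg) hmg⟩
  have hMS : M ⊆ S := hM ▸ fun _ h => h.1
  refine ⟨?_, fun x => ?_⟩
  · obtain ⟨h, hh⟩ := hconv.1
    obtain ⟨m, hm, -⟩ := hmax h hh
    exact ⟨m, hm⟩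
  · rw [hconv.2 x]
    refine le_antisymm (iSup₂_le fun h hh => ?_) (biSup_mono hMS)
    obtain ⟨m, hm, hhm⟩ := hmax h hh
    exact (EReal.coe_le_coe_iff.2 (hhm x)).trans
      (le_iSup₂ (f := fun (h : X → ℝ) (_ : h ∈ M) => ((h x : ℝ) : EReal)) m hm)
end

section
/- Let X be a real normed space and let f : X → ℝ ∪ {−∞, +∞} satisfy dom f ≠ ∅. Then f is bounded from below by a Lipschitz continuous function g : X → ℝ if and only if the set S⁻max(LĈ, f) of maximal LĈ-minorants of f is nonempty; moreover, in this case every LĈ-minorant h of f satisfies h ≤ h̄ pointwise for some maximal LĈ-minorant h̄ of f. -/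
/-- A concave function that dominates a `k`-Lipschitz function is itself `k`-Lipschitz. -/
theorem ConcaveOn.lipschitz_of_ge {X : Type*} [NormedAddCommGroup X] [NormedSpace ℝ X]
    {g h : X → ℝ} {k : ℝ} (hg : ConcaveOn ℝ Set.univ g)
    (hh : ∀ x y : X, |h x - h y| ≤ k * ‖x - y‖) (hle : h ≤ g) (x y : X) :
    |g x - g y| ≤ k * ‖x - y‖ := by
  have key : ∀ x y : X, g x - g y ≤ k * ‖x - y‖ := by
    intro x y
    refine le_of_forall_pos_le_add fun ε hε => ?_
    have hD : 0 ≤ g x - h x := sub_nonneg.2 (hle x)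
    obtain ⟨s, hs0, hs1, hsD⟩ : ∃ s : ℝ, 0 < s ∧ s ≤ 1 ∧ s * (g x - h x) ≤ ε := by
      refine ⟨ε / (g x - h x + 1 + ε), by positivity, ?_, ?_⟩
      · rw [div_le_one (by positivity)]; linarith
      · rw [div_mul_eq_mul_div, div_le_iff₀ (by positivity)]
        nlinarith
    have hpt : (1 - s) • x + s • (x + s⁻¹ • (y - x)) = y := by
      rw [smul_add, smul_inv_smul₀ hs0.ne', sub_smul, one_smul]
      abel
    have hconc := hg.2 (Set.mem_univ x) (Set.mem_univ (x + s⁻¹ • (y - x)))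
      (sub_nonneg.2 hs1) hs0.le (by ring)
    rw [hpt, smul_eq_mul, smul_eq_mul] at hconc
    have hlip := (abs_le.1 (hh x (x + s⁻¹ • (y - x)))).2
    have hnorm : ‖x - (x + s⁻¹ • (y - x))‖ = s⁻¹ * ‖x - y‖ := by
      rw [sub_add_cancel_left, norm_neg, norm_smul, Real.norm_of_nonneg (by positivity),
        norm_sub_rev]
    rw [hnorm] at hlip
    have hmul := mul_le_mul_of_nonneg_left
      (hlip.trans' (sub_le_sub_left (hle (x + s⁻¹ • (y - x))) (h x))) hs0.le
    have hcancel : s * (k * (s⁻¹ * ‖x - y‖)) = k * ‖x - y‖ := by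
      field_simp
    rw [hcancel] at hmul
    linarith
  rw [abs_le]
  have h₁ := key y x
  rw [norm_sub_rev] at h₁
  exact ⟨by linarith, key x y⟩

/-- The pointwise supremum of a nonempty, pointwise bounded chain of concave functions is
concave. -/
theorem concaveOn_sSup_of_isChain {X : Type*} [AddCommGroup X] [Module ℝ X]
    {c : Set (X → ℝ)} (hc : IsChain (· ≤ ·) c) (hne : c.Nonempty)
    (hconc : ∀ g ∈ c, ConcaveOn ℝ Set.univ g)
    (hbdd : ∀ x, BddAbove ((fun g : X → ℝ => g x) '' c)) :
    ConcaveOn ℝ Set.univ (fun x => sSup ((fun g : X → ℝ => g x) '' c)) := by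
  refine ⟨convex_univ, fun x _ y _ a b ha hb hab => le_of_forall_pos_le_add fun ε hε => ?_⟩
  simp only [smul_eq_mul]
  obtain ⟨_, ⟨g₁, hg₁, rfl⟩, h₁⟩ := exists_lt_of_lt_csSup (hne.image (fun g : X → ℝ => g x))
    (sub_lt_self (sSup ((fun g : X → ℝ => g x) '' c)) hε)
  obtain ⟨_, ⟨g₂, hg₂, rfl⟩, h₂⟩ := exists_lt_of_lt_csSup (hne.image (fun g : X → ℝ => g y))
    (sub_lt_self (sSup ((fun g : X → ℝ => g y) '' c)) hε)
  obtain ⟨g, hg, hg₁g, hg₂g⟩ := hc.directedOn g₁ hg₁ g₂ hg₂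
  have hx := mul_le_mul_of_nonneg_left (h₁.le.trans (hg₁g x)) ha
  have hy := mul_le_mul_of_nonneg_left (h₂.le.trans (hg₂g y)) hb
  have hgc := (hconc g hg).2 (Set.mem_univ x) (Set.mem_univ y) ha hb hab
  have hle := le_csSup (hbdd (a • x + b • y)) ⟨g, hg, rfl⟩
  simp only [smul_eq_mul] at hgc hle
  have hε' : a * ε + b * ε = ε := by rw [← add_mul, hab, one_mul]
  linarith

/-- A concave Lipschitz minorant of a function finite somewhere lies below a maximal one. -/
theorem exists_maximal_concave_lipschitz_minorant {X : Type*} [NormedAddCommGroup X]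
    [NormedSpace ℝ X] {f : X → EReal} {x₀ : X} (hx₀ : f x₀ ≠ ⊤) {h : X → ℝ} {k : ℝ}
    (hk : 0 ≤ k) (hconc : ConcaveOn ℝ Set.univ h)
    (hlip : ∀ x y : X, |h x - h y| ≤ k * ‖x - y‖) (hf : ∀ x, (h x : EReal) ≤ f x) :
    ∃ m, h ≤ m ∧ Maximal (· ∈ {g : X → ℝ | (ConcaveOn ℝ Set.univ g ∧
        ∃ k : ℝ, 0 ≤ k ∧ ∀ x y : X, |g x - g y| ≤ k * ‖x - y‖) ∧
        ∀ x, (g x : EReal) ≤ f x}) m := by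
  obtain ⟨m, hhm, hm⟩ := zorn_le_nonempty₀
    {g : X → ℝ | ConcaveOn ℝ Set.univ g ∧ h ≤ g ∧ ∀ x, (g x : EReal) ≤ f x}
    (fun c hcS hc y hy => by
      have hbdd : ∀ x, BddAbove ((fun g : X → ℝ => g x) '' c) := by
        refine fun x => ⟨(f x₀).toReal + k * ‖x - x₀‖, ?_⟩
        rintro _ ⟨g, hg, rfl⟩
        have h₁ := (abs_le.1 ((hcS hg).1.lipschitz_of_ge hlip (hcS hg).2.1 x x₀)).2
        have h₂ := EReal.toReal_le_toReal ((hcS hg).2.2 x₀) (EReal.coe_ne_bot _) hx₀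
        rw [EReal.toReal_coe] at h₂
        simp only
        linarith
      have hub : ∀ g ∈ c, g ≤ fun x => sSup ((fun g : X → ℝ => g x) '' c) :=
        fun g hg x => le_csSup (hbdd x) ⟨g, hg, rfl⟩
      refine ⟨_, ⟨concaveOn_sSup_of_isChain hc ⟨y, hy⟩ (fun g hg => (hcS hg).1) hbdd,
        (hcS hy).2.1.trans (hub y hy), fun x => ?_⟩, hub⟩
      by_cases htop : f x = ⊤
      · simp [htop]
      refine le_trans (EReal.coe_le_coe_iff.2 (csSup_le (Set.Nonempty.image _ ⟨y, hy⟩) ?_))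
        (EReal.coe_toReal htop
          (ne_bot_of_le_ne_bot (EReal.coe_ne_bot _) (hf x))).le
      rintro _ ⟨g, hg, rfl⟩
      have h₂ := EReal.toReal_le_toReal ((hcS hg).2.2 x) (EReal.coe_ne_bot _) htop
      rwa [EReal.toReal_coe] at h₂) h ⟨hconc, le_rfl, hf⟩
  refine ⟨m, hhm, ⟨⟨hm.prop.1, k, hk, hm.prop.1.lipschitz_of_ge hlip hhm⟩, hm.prop.2.2⟩, ?_⟩
  exact fun g hg hmg => hm.2 ⟨hg.1.1, hhm.trans hmg, hg.2⟩ hmg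


/-- For `f : X → ℝ ∪ {−∞, +∞}` with nonempty effective domain, `f` is bounded
from below by a Lipschitz continuous function iff the set of maximal `LĈ`-minorants of `f`
is nonempty; and in this case every `LĈ`-minorant of `f` is dominated pointwise by a
maximal `LĈ`-minorant. -/
theorem statement5 {X : Type*} [NormedAddCommGroup X] [NormedSpace ℝ X]
    (f : X → EReal) (hdom : ∃ x, f x ≠ ⊤ ∧ f x ≠ ⊥)
    (S : Set (X → ℝ))
    (hS : S = {h : X → ℝ | (ConcaveOn ℝ Set.univ h ∧
        ∃ k : ℝ, 0 ≤ k ∧ ∀ x y : X, |h x - h y| ≤ k * ‖x - y‖) ∧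
        ∀ x, (h x : EReal) ≤ f x})
    (M : Set (X → ℝ)) (hM : M = {h ∈ S | ∀ g ∈ S, h ≤ g → g = h}) :
    ((∃ g : X → ℝ, (∃ k : ℝ, 0 ≤ k ∧ ∀ x y : X, |g x - g y| ≤ k * ‖x - y‖) ∧
        ∀ x, (g x : EReal) ≤ f x) ↔ M.Nonempty) ∧
    (M.Nonempty → ∀ h ∈ S, ∃ hb ∈ M, h ≤ hb) := by
  obtain ⟨x₀, hx₀, -⟩ := hdom
  have hmax : ∀ h ∈ S, ∃ hb ∈ M, h ≤ hb := by
    subst hM hS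
    rintro h ⟨⟨hconc, k, hk, hlip⟩, hf⟩
    obtain ⟨m, hhm, hm⟩ := exists_maximal_concave_lipschitz_minorant hx₀ hk hconc hlip hf
    exact ⟨m, ⟨hm.prop, fun g hg hmg => le_antisymm (hm.2 hg hmg) hmg⟩, hhm⟩
  refine ⟨⟨?_, ?_⟩, fun _ => hmax⟩
  · rintro ⟨g, ⟨k, hk, hlip⟩, hf⟩
    have hmem : (fun x => g x₀ - k * dist x x₀) ∈ S := by
      rw [hS]
      refine ⟨⟨(concaveOn_const _ convex_univ).sub
        ((convexOn_dist x₀ convex_univ).smul hk), k, hk, fun x y => ?_⟩, fun x => ?_⟩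
      · rw [sub_sub_sub_cancel_left, ← mul_sub, abs_mul, abs_of_nonneg hk, ← dist_eq_norm,
          dist_comm x y]
        refine mul_le_mul_of_nonneg_left ?_ hk
        exact abs_dist_sub_le y x x₀
      · refine le_trans (EReal.coe_le_coe_iff.2 ?_) (hf x)
        have := (abs_le.1 (hlip x x₀)).1
        rw [← dist_eq_norm] at this
        linarith
    obtain ⟨m, hm, -⟩ := hmax _ hmem
    exact ⟨m, hm⟩
  · rintro ⟨m, hm⟩
    subst hM hS
    exact ⟨m, hm.1.1.2, hm.1.2⟩
end

section
/- Let X be a real normed space and let f : X → ℝ ∪ {+∞} be proper (dom f ≠ ∅). Then f is lower semicontinuous and convex if and only if f is regularly LĈ-convex and every maximal LĈ-minorant of f is a continuous affine function, i.e. of the form x ↦ x*(x) + c with x* a continuous linear functional on X and c ∈ ℝ. -/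
/-- A nonnegative concave function on a whole real vector space is constant. -/
theorem ConcaveOn.le_of_nonneg {X : Type*} [AddCommGroup X] [Module ℝ X] {k : X → ℝ}
    (hk : ConcaveOn ℝ Set.univ k) (h0 : ∀ x, 0 ≤ k x) (x y : X) : k y ≤ k x := by
  by_contra! hlt
  have hy : 0 < k y := (h0 x).trans_lt hlt
  set t := (k x + k y) / (2 * k y) with ht
  have ht0 : 0 < t := by have := h0 x; positivity
  have ht1 : t < 1 := by rw [ht, div_lt_one (by positivity)]; linarith
  have hmul : t * k y = (k x + k y) / 2 := by rw [ht]; field_simp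
  have hne : (1 - t) ≠ 0 := by linarith
  have key := hk.2 (Set.mem_univ ((1 - t)⁻¹ • (x - t • y))) (Set.mem_univ y)
    (sub_nonneg.2 ht1.le) ht0.le (by ring)
  rw [smul_inv_smul₀ hne, sub_add_cancel, smul_eq_mul, smul_eq_mul] at key
  have := mul_nonneg (sub_nonneg.2 ht1.le) (h0 ((1 - t)⁻¹ • (x - t • y)))
  linarith

theorem EReal.coe_le_of_forall_coe_ge {r : ℝ} {e : EReal}
    (h : ∀ t : ℝ, e ≤ t → r ≤ t) : (r : EReal) ≤ e :=
  EReal.le_of_forall_lt_iff_le.1 fun t ht => EReal.coe_le_coe_iff.2 (h t ht.le)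

theorem ContinuousLinearMap.prod_real_apply {X : Type*} [NormedAddCommGroup X] [NormedSpace ℝ X]
    (F : X × ℝ →L[ℝ] ℝ) (x : X) (t : ℝ) :
    F (x, t) = F.comp (ContinuousLinearMap.inl ℝ X ℝ) x + t * F (0, 1) := by
  have : (x, t) = (x, (0 : ℝ)) + t • ((0 : X), (1 : ℝ)) := by simp
  rw [this, map_add, map_smul]
  simp

theorem isClosed_epigraph_real {X : Type*} [TopologicalSpace X] {f : X → EReal}
    (hlsc : LowerSemicontinuous f) :
    IsClosed {p : X × ℝ | f p.1 ≤ p.2} :=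
  hlsc.isClosed_epigraph.preimage
    (continuous_fst.prodMk (continuous_coe_real_ereal.comp continuous_snd))

/-- A minorant of a proper function can be raised to a translate that is
largest among the translates below the function. -/
theorem exists_maximal_translate {X : Type*} {f : X → EReal} {φ : X → ℝ} {c : ℝ}
    (hle : ∀ x, ((φ x + c : ℝ) : EReal) ≤ f x) {x₁ : X} {t₁ : ℝ} (h₁ : f x₁ = t₁) :
    ∃ c', c ≤ c' ∧ (∀ x, ((φ x + c' : ℝ) : EReal) ≤ f x) ∧
      ∀ d, (∀ x, ((φ x + d : ℝ) : EReal) ≤ f x) → d ≤ c' := by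
  set D := {d : ℝ | ∀ x, ((φ x + d : ℝ) : EReal) ≤ f x}
  have hbdd : BddAbove D := by
    refine ⟨t₁ - φ x₁, fun d hd => ?_⟩
    have := EReal.coe_le_coe_iff.1 (h₁ ▸ hd x₁)
    linarith
  refine ⟨sSup D, le_csSup hbdd hle, fun x => ?_, fun d hd => le_csSup hbdd hd⟩
  refine EReal.coe_le_of_forall_coe_ge fun t ht => ?_
  have : sSup D ≤ t - φ x := csSup_le ⟨c, hle⟩ fun d hd => by
    have := EReal.coe_le_coe_iff.1 ((hd x).trans ht)
    linarith
  linarith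

section

variable {X : Type*} [NormedAddCommGroup X] [NormedSpace ℝ X] {f : X → EReal}

/-- A non-vertical hyperplane below the epigraph of `f` is the graph of an affine minorant. -/
theorem affine_le_of_le_on_epigraph {φ : X →L[ℝ] ℝ} {α u : ℝ} (hα : 0 < α)
    (h : ∀ x (t : ℝ), f x ≤ t → u ≤ φ x + t * α) (x : X) :
    (((-(α⁻¹ • φ)) x + u / α : ℝ) : EReal) ≤ f x := by
  refine EReal.coe_le_of_forall_coe_ge fun t ht => ?_
  have := h x t ht
  simp only [neg_apply, smul_apply, smul_eq_mul]
  rw [show -(α⁻¹ * φ x) + u / α = (u - φ x) / α by field_simp; ring, div_le_iff₀ hα]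
  linarith

theorem convex_epigraph_real (hconv : ∀ (x y : X) (a b : ℝ), 0 < a → 0 < b → a + b = 1 →
    f (a • x + b • y) ≤ (a : EReal) * f x + (b : EReal) * f y) :
    Convex ℝ {p : X × ℝ | f p.1 ≤ p.2} := by
  rw [convex_iff_forall_pos]
  rintro ⟨x, s⟩ hx ⟨y, t⟩ hy a b ha hb hab
  have ha' : (0 : EReal) ≤ a := EReal.coe_nonneg.2 ha.le
  have hb' : (0 : EReal) ≤ b := EReal.coe_nonneg.2 hb.le
  refine (hconv x y a b ha hb hab).trans ?_
  have := add_le_add (mul_le_mul_of_nonneg_left hx ha') (mul_le_mul_of_nonneg_left hy hb')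
  simpa using this

/-- Sandwich: between a continuous concave function and a proper convex function above it lies
a continuous affine function. -/
theorem exists_affine_between {h : X → ℝ} (hconc : ConcaveOn ℝ Set.univ h) (hcont : Continuous h)
    (hconv : ∀ (x y : X) (a b : ℝ), 0 < a → 0 < b → a + b = 1 →
      f (a • x + b • y) ≤ (a : EReal) * f x + (b : EReal) * f y)
    {x₁ : X} {t₁ : ℝ} (h₁ : f x₁ = t₁) (hle : ∀ x, (h x : EReal) ≤ f x) :
    ∃ (φ : X →L[ℝ] ℝ) (c : ℝ), (∀ x, h x ≤ φ x + c) ∧ ∀ x, ((φ x + c : ℝ) : EReal) ≤ f x := by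
  have hopen : IsOpen {p : X × ℝ | p.2 < h p.1} :=
    isOpen_lt continuous_snd (hcont.comp continuous_fst)
  have hcvx : Convex ℝ {p : X × ℝ | p.2 < h p.1} := by
    simpa using hconc.convex_strict_hypograph
  have hdisj : Disjoint {p : X × ℝ | p.2 < h p.1} {p : X × ℝ | f p.1 ≤ p.2} := by
    rw [Set.disjoint_left]
    intro p hp hp'
    exact absurd (EReal.coe_le_coe_iff.1 ((hle p.1).trans hp')) (not_le.2 hp)
  obtain ⟨F, u, hlt, hge⟩ :=
    geometric_hahn_banach_open hcvx hopen (convex_epigraph_real hconv) hdisj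
  set φ := F.comp (ContinuousLinearMap.inl ℝ X ℝ)
  set α := F (0, 1)
  have hlow : ∀ x t, t < h x → φ x + t * α < u := fun x t ht => by
    rw [← F.prod_real_apply]; exact hlt (x, t) ht
  have hup : ∀ x (t : ℝ), f x ≤ t → u ≤ φ x + t * α := fun x t ht => by
    rw [← F.prod_real_apply]; exact hge (x, t) ht
  have hα : 0 < α := by
    have hh : h x₁ ≤ t₁ := EReal.coe_le_coe_iff.1 (h₁ ▸ hle x₁)
    have a1 := hlow x₁ (h x₁ - 1) (by linarith)
    have a2 := hup x₁ t₁ h₁.le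
    by_contra! hneg
    nlinarith
  refine ⟨-(α⁻¹ • φ), u / α, fun x => ?_, affine_le_of_le_on_epigraph hα hup⟩
  refine le_of_forall_lt fun t ht => ?_
  have := hlow x t ht
  simp only [neg_apply, smul_apply, smul_eq_mul]
  rw [show -(α⁻¹ * φ x) + u / α = (u - φ x) / α by field_simp; ring, lt_div_iff₀ hα]
  linarith

/-- A proper lower semicontinuous convex function is the supremum of its continuous affine
minorants. -/
theorem exists_affine_minorant_gt (hlsc : LowerSemicontinuous f)
    (hconv : ∀ (x y : X) (a b : ℝ), 0 < a → 0 < b → a + b = 1 →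
      f (a • x + b • y) ≤ (a : EReal) * f x + (b : EReal) * f y)
    {x₁ : X} {t₁ : ℝ} (h₁ : f x₁ = t₁) {x₀ : X} {r : ℝ} (hr : (r : EReal) < f x₀) :
    ∃ (φ : X →L[ℝ] ℝ) (c : ℝ), r < φ x₀ + c ∧ ∀ x, ((φ x + c : ℝ) : EReal) ≤ f x := by
  have sep : ∀ (x : X) (s : ℝ), (s : EReal) < f x → ∃ (φ : X →L[ℝ] ℝ) (α u : ℝ),
      φ x + s * α < u ∧ ∀ y (t : ℝ), f y ≤ t → u < φ y + t * α := by
    intro x s hs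
    obtain ⟨F, u, hlt, hge⟩ := geometric_hahn_banach_point_closed (convex_epigraph_real hconv)
      (isClosed_epigraph_real hlsc) (x := (x, s)) (not_le.2 hs)
    refine ⟨F.comp (ContinuousLinearMap.inl ℝ X ℝ), F (0, 1), u, ?_, fun y t ht => ?_⟩
    · rwa [← F.prod_real_apply]
    · rw [← F.prod_real_apply]; exact hge (y, t) ht
  have pos : ∀ (x : X) (s : ℝ) (φ : X →L[ℝ] ℝ) (α u : ℝ), 0 < α → φ x + s * α < u →
      (∀ y (t : ℝ), f y ≤ t → u < φ y + t * α) →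
      ∃ (φ : X →L[ℝ] ℝ) (c : ℝ), s < φ x + c ∧ ∀ x, ((φ x + c : ℝ) : EReal) ≤ f x := by
    intro x s φ α u hα hs hup
    refine ⟨-(α⁻¹ • φ), u / α, ?_,
      affine_le_of_le_on_epigraph hα fun y t ht => (hup y t ht).le⟩
    simp only [neg_apply, smul_apply, smul_eq_mul]
    rw [show -(α⁻¹ * φ x) + u / α = (u - φ x) / α by field_simp; ring, lt_div_iff₀ hα]
    linarith
  obtain ⟨φ, α, u, hlow, hup⟩ := sep x₀ r hr
  have hα : 0 ≤ α := by
    by_contra! hneg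
    have hs : 0 ≤ |φ x₁ + t₁ * α - u| / (-α) := div_nonneg (abs_nonneg _) (by linarith)
    have := hup x₁ (t₁ + |φ x₁ + t₁ * α - u| / (-α))
      (h₁.le.trans (EReal.coe_le_coe_iff.2 (by linarith)))
    have e : |φ x₁ + t₁ * α - u| / (-α) * α = -|φ x₁ + t₁ * α - u| := by
      rw [div_neg, neg_mul, div_mul_cancel₀ _ hneg.ne]
    rw [add_mul, e] at this
    have := le_abs_self (φ x₁ + t₁ * α - u)
    linarith
  rcases hα.lt_or_eq with hα | rfl
  · exact pos x₀ r φ α u hα hlow hup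
  -- The separating hyperplane is vertical: tilt an arbitrary affine minorant along it.
  obtain ⟨ψ, c, -, hψ⟩ : ∃ (ψ : X →L[ℝ] ℝ) (c : ℝ), t₁ - 1 < ψ x₁ + c ∧
      ∀ x, ((ψ x + c : ℝ) : EReal) ≤ f x := by
    obtain ⟨ψ, β, v, hl, hu⟩ := sep x₁ (t₁ - 1) (h₁ ▸ EReal.coe_lt_coe_iff.2 (by linarith))
    have := hu x₁ t₁ h₁.le
    exact pos _ _ ψ β v (by linarith) hl hu
  have hd : 0 < u - φ x₀ := by linarith
  obtain ⟨n, hn⟩ := exists_nat_gt ((r - (ψ x₀ + c)) / (u - φ x₀))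
  rw [div_lt_iff₀ hd] at hn
  refine ⟨ψ - (n : ℝ) • φ, c + n * u, ?_, fun x => ?_⟩
  · simp only [sub_apply, smul_apply, smul_eq_mul]
    linarith
  · refine EReal.coe_le_of_forall_coe_ge fun t ht => ?_
    have a1 := hup x t ht
    have a2 := EReal.coe_le_coe_iff.1 ((hψ x).trans ht)
    have a3 : (n : ℝ) * (u - φ x) ≤ 0 :=
      mul_nonpos_of_nonneg_of_nonpos n.cast_nonneg (by linarith)
    simp only [sub_apply, smul_apply, smul_eq_mul]
    linarith

end

/-- A proper function `f : X → ℝ ∪ {+∞}` on a real normed space is lower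
semicontinuous and convex iff it is regularly `LĈ`-convex and every maximal `LĈ`-minorant
of `f` is a continuous affine function `x ↦ x*(x) + c`. -/
theorem statement6 {X : Type*} [NormedAddCommGroup X] [NormedSpace ℝ X]
    (f : X → EReal) (hf_nebot : ∀ x, f x ≠ ⊥) (hf_proper : ∃ x, f x ≠ ⊤)
    (S : Set (X → ℝ))
    (hS : S = {h : X → ℝ | (ConcaveOn ℝ Set.univ h ∧
        ∃ k : ℝ, 0 ≤ k ∧ ∀ x y : X, |h x - h y| ≤ k * ‖x - y‖) ∧
        ∀ x, (h x : EReal) ≤ f x})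
    (M : Set (X → ℝ)) (hM : M = {h ∈ S | ∀ g ∈ S, h ≤ g → g = h}) :
    (LowerSemicontinuous f ∧ ∀ (x y : X) (a b : ℝ), 0 < a → 0 < b → a + b = 1 →
        f (a • x + b • y) ≤ (a : EReal) * f x + (b : EReal) * f y) ↔
    ((M.Nonempty ∧ ∀ x, f x = ⨆ h ∈ M, ((h x : ℝ) : EReal)) ∧
      ∀ h ∈ M, ∃ (φ : X →L[ℝ] ℝ) (c : ℝ), h = fun x => φ x + c) := by
  subst hS
  set S := {h : X → ℝ | (ConcaveOn ℝ Set.univ h ∧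
        ∃ k : ℝ, 0 ≤ k ∧ ∀ x y : X, |h x - h y| ≤ k * ‖x - y‖) ∧
        ∀ x, (h x : EReal) ≤ f x}
  subst hM
  have affine_mem : ∀ (φ : X →L[ℝ] ℝ) (c : ℝ), (∀ x, ((φ x + c : ℝ) : EReal) ≤ f x) →
      (fun x => φ x + c) ∈ S := by
    refine fun φ c hle => ⟨⟨?_, ‖φ‖, norm_nonneg _, fun x y => ?_⟩, hle⟩
    · exact (φ.toLinearMap.concaveOn convex_univ).add_const c
    · rw [add_sub_add_right_eq_sub, ← map_sub]
      exact φ.le_opNorm _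
  constructor
  · rintro ⟨hlsc, hconv⟩
    obtain ⟨x₁, hx₁⟩ := hf_proper
    obtain ⟨t₁, h₁⟩ : ∃ t : ℝ, f x₁ = t :=
      ⟨(f x₁).toReal, (EReal.coe_toReal hx₁ (hf_nebot x₁)).symm⟩
    have approx : ∀ (x : X) (r : ℝ), (r : EReal) < f x →
        ∃ h ∈ {h ∈ S | ∀ g ∈ S, h ≤ g → g = h}, r < h x := by
      intro x r hr
      obtain ⟨φ, c, hrc, hle⟩ := exists_affine_minorant_gt hlsc hconv h₁ hr
      obtain ⟨c', hcc', hle', hmax⟩ := exists_maximal_translate hle h₁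
      refine ⟨fun x => φ x + c', ⟨affine_mem φ c' hle', fun g hg hge => ?_⟩, by linarith⟩
      have hconc : ConcaveOn ℝ Set.univ (fun x => g x - (φ x + c')) :=
        hg.1.1.sub ((φ.toLinearMap.convexOn convex_univ).add_const c')
      have hcst := hconc.le_of_nonneg fun y => sub_nonneg.2 (hge y)
      have hd : c' + (g 0 - (φ 0 + c')) ≤ c' := hmax _ fun y => by
        refine le_trans (EReal.coe_le_coe_iff.2 ?_) (hg.2 y)
        have := hcst y 0
        linarith
      funext y
      have a1 := hcst 0 y
      have a2 : φ y + c' ≤ g y := hge y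
      linarith
    refine ⟨⟨?_, fun x => le_antisymm ?_ (iSup₂_le fun h hh => hh.1.2 x)⟩, fun h hh => ?_⟩
    · obtain ⟨h, hh, -⟩ := approx x₁ (t₁ - 1) (h₁ ▸ EReal.coe_lt_coe_iff.2 (by linarith))
      exact ⟨h, hh⟩
    · refine EReal.ge_of_forall_gt_iff_ge.1 fun r hr => ?_
      obtain ⟨h, hh, hrh⟩ := approx x r hr
      exact (EReal.coe_le_coe_iff.2 hrh.le).trans
        (le_iSup₂ (f := fun (h : X → ℝ) (_ : h ∈ {h ∈ S | ∀ g ∈ S, h ≤ g → g = h}) =>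
          ((h x : ℝ) : EReal)) h hh)
    · obtain ⟨⟨⟨hconc, k, hk0, hk⟩, hle⟩, hmax⟩ := hh
      have hcont : Continuous h := (LipschitzWith.of_dist_le_mul (K := ⟨k, hk0⟩) fun x y => by
        rw [Real.dist_eq, dist_eq_norm]; exact hk x y).continuous
      obtain ⟨φ, c, hge, hle'⟩ := exists_affine_between hconc hcont hconv h₁ hle
      exact ⟨φ, c, (hmax _ (affine_mem φ c hle') hge).symm⟩
  · rintro ⟨⟨-, hsup⟩, haff⟩
    constructor
    · rw [show f = _ from funext hsup]
      refine lowerSemicontinuous_iSup fun h => lowerSemicontinuous_iSup fun hh => ?_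
      obtain ⟨φ, c, rfl⟩ := haff h hh
      exact (continuous_coe_real_ereal.comp (by fun_prop)).lowerSemicontinuous
    · intro x y a b ha hb hab
      rw [hsup (a • x + b • y)]
      refine iSup₂_le fun h hh => ?_
      have ha' : (0 : EReal) ≤ a := EReal.coe_nonneg.2 ha.le
      have hb' : (0 : EReal) ≤ b := EReal.coe_nonneg.2 hb.le
      have key := add_le_add (mul_le_mul_of_nonneg_left (hh.1.2 x) ha')
        (mul_le_mul_of_nonneg_left (hh.1.2 y) hb')
      refine le_trans (le_of_eq ?_) key
      obtain ⟨φ, c, rfl⟩ := haff h hh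
      rw [← EReal.coe_mul, ← EReal.coe_mul, ← EReal.coe_add]
      congr 1
      simp only [map_add, map_smul, smul_eq_mul]
      linear_combination -c * hab
end

section
/- Let X be a real normed space, f : X → ℝ ∪ {−∞, +∞}, and x̄ ∈ dom f. Then f is LĈ-subdifferentiable at x̄ if and only if there exists a constant k ≥ 0 such that f(x) ≥ f(x̄) − k·‖x − x̄‖ for all x ∈ X. -/
/-- The cone `x ↦ r - k * ‖x - x₀‖` with `k ≥ 0` is concave. -/
theorem concaveOn_sub_mul_norm_sub {X : Type*} [NormedAddCommGroup X] [NormedSpace ℝ X]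
    (x₀ : X) (r : ℝ) {k : ℝ} (hk : 0 ≤ k) :
    ConcaveOn ℝ Set.univ fun x : X => r - k * ‖x - x₀‖ := by
  have hdist : ConvexOn ℝ Set.univ fun x : X => k * ‖x - x₀‖ := by
    simpa only [dist_eq_norm, smul_eq_mul] using (convexOn_univ_dist x₀).smul hk
  exact (concaveOn_const r convex_univ).sub hdist

/-- The cone `x ↦ r - k * ‖x - x₀‖` with `k ≥ 0` is Lipschitz with constant `k`. -/
theorem abs_sub_mul_norm_sub_le {X : Type*} [NormedAddCommGroup X]
    (x₀ : X) (r : ℝ) {k : ℝ} (hk : 0 ≤ k) (x y : X) :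
    |(r - k * ‖x - x₀‖) - (r - k * ‖y - x₀‖)| ≤ k * ‖x - y‖ := by
  have hnorm : |‖y - x₀‖ - ‖x - x₀‖| ≤ ‖x - y‖ := by
    simpa [norm_sub_rev y x] using abs_norm_sub_norm_le (y - x₀) (x - x₀)
  calc |(r - k * ‖x - x₀‖) - (r - k * ‖y - x₀‖)|
      = |k * (‖y - x₀‖ - ‖x - x₀‖)| := by ring_nf
    _ = k * |‖y - x₀‖ - ‖x - x₀‖| := by rw [abs_mul, abs_of_nonneg hk]
    _ ≤ k * ‖x - y‖ := mul_le_mul_of_nonneg_left hnorm hk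

/-- For `f : X → ℝ ∪ {−∞, +∞}` and `x₀ ∈ dom f` (with finite value `r`),
`f` is `LĈ`-subdifferentiable at `x₀` iff there exists `k ≥ 0` such that
`f(x) ≥ f(x₀) − k‖x − x₀‖` for all `x ∈ X`. -/
theorem statement8 {X : Type*} [NormedAddCommGroup X] [NormedSpace ℝ X]
    (f : X → EReal) (x₀ : X) (r : ℝ) (hx₀ : f x₀ = (r : EReal)) :
    (∃ h : X → ℝ, (ConcaveOn ℝ Set.univ h ∧
        ∃ k : ℝ, 0 ≤ k ∧ ∀ x y : X, |h x - h y| ≤ k * ‖x - y‖) ∧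
        (∀ x, (h x : EReal) ≤ f x) ∧ (h x₀ : EReal) = f x₀) ↔
    (∃ k : ℝ, 0 ≤ k ∧ ∀ x : X, ((r - k * ‖x - x₀‖ : ℝ) : EReal) ≤ f x) := by
  constructor
  · rintro ⟨h, ⟨-, k, hk, hlip⟩, hle, heq⟩
    have hr : h x₀ = r := EReal.coe_injective (heq.trans hx₀)
    refine ⟨k, hk, fun x => le_trans (EReal.coe_le_coe_iff.2 ?_) (hle x)⟩
    have hx := (abs_le.1 (hlip x x₀)).1
    linarith
  · rintro ⟨k, hk, hle⟩
    refine ⟨fun x => r - k * ‖x - x₀‖, ⟨concaveOn_sub_mul_norm_sub x₀ r hk, k, hk,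
      abs_sub_mul_norm_sub_le x₀ r hk⟩, hle, ?_⟩
    simp [hx₀]
end

section
/- If f : X → ℝ is Lipschitz continuous on a real normed space X, then f is LĈ-subdifferentiable at every point x̄ ∈ X. -/
/-- A Lipschitz continuous function `f : X → ℝ` on a real normed space is
`LĈ`-subdifferentiable at every point `x₀ ∈ X`. -/
theorem statement9 {X : Type*} [NormedAddCommGroup X] [NormedSpace ℝ X]
    (f : X → ℝ) (hf : ∃ k : ℝ, 0 ≤ k ∧ ∀ x y : X, |f x - f y| ≤ k * ‖x - y‖)
    (x₀ : X) :
    ∃ h : X → ℝ, (ConcaveOn ℝ Set.univ h ∧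
        ∃ k : ℝ, 0 ≤ k ∧ ∀ x y : X, |h x - h y| ≤ k * ‖x - y‖) ∧
      (∀ x, h x ≤ f x) ∧ h x₀ = f x₀ := by
  obtain ⟨k, hk, hf⟩ := hf
  refine ⟨fun x => f x₀ - k * dist x x₀, ⟨?_, k, hk, fun x y => ?_⟩, fun x => ?_, by simp⟩
  · exact (concaveOn_const _ convex_univ).sub ((convexOn_univ_dist x₀).smul hk)
  · calc |f x₀ - k * dist x x₀ - (f x₀ - k * dist y x₀)|
        = k * |dist x x₀ - dist y x₀| := by
          rw [← abs_of_nonneg hk, ← abs_mul, abs_of_nonneg hk, ← abs_neg]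
          ring_nf
      _ ≤ k * ‖x - y‖ := by
          rw [← dist_eq_norm]
          exact mul_le_mul_of_nonneg_left (abs_dist_sub_le x y x₀) hk
  · have hx := neg_le_of_abs_le (hf x x₀)
    rw [← dist_eq_norm] at hx
    linarith
end

section
/- Let X be a real normed space, f : X → ℝ ∪ {−∞, +∞}, and x̄ ∈ dom f. If a : X → ℝ is a continuous affine function (a(x) = x*(x) + c with x* a continuous linear functional and c ∈ ℝ) such that a(x) ≤ f(x) for all x ∈ X and a(x̄) = f(x̄), then a is a maximal element of S⁻(LĈ, f) for the pointwise order, i.e. a ∈ S⁻max(LĈ, f, x̄). -/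
/-- If a continuous affine function `a(x) = x*(x) + c` is an `LĈ`-minorant
of `f` supporting `f` from below at a point `x₀ ∈ dom f`, then `a` is a maximal element
of `S⁻(LĈ, f)` for the pointwise order, i.e. `a ∈ S⁻max(LĈ, f, x₀)`. -/
theorem statement10 {X : Type*} [NormedAddCommGroup X] [NormedSpace ℝ X]
    (f : X → EReal) (x₀ : X) (hx₀ : f x₀ ≠ ⊤ ∧ f x₀ ≠ ⊥)
    (φ : X →L[ℝ] ℝ) (c : ℝ) (a : X → ℝ) (ha : a = fun x => φ x + c)
    (hmin : ∀ x, (a x : EReal) ≤ f x) (hsupp : (a x₀ : EReal) = f x₀)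
    (S : Set (X → ℝ))
    (hS : S = {h : X → ℝ | (ConcaveOn ℝ Set.univ h ∧
        ∃ k : ℝ, 0 ≤ k ∧ ∀ x y : X, |h x - h y| ≤ k * ‖x - y‖) ∧
        ∀ x, (h x : EReal) ≤ f x}) :
    a ∈ S ∧ ∀ g ∈ S, a ≤ g → g = a := by
  subst ha hS
  refine ⟨⟨⟨⟨convex_univ, fun x _ y _ s t _ _ hst => ?_⟩, ‖φ‖, norm_nonneg φ, fun x y => ?_⟩,
    hmin⟩, ?_⟩
  · simp only [map_add, map_smul, smul_eq_mul]
    linear_combination c * hst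
  · simpa [← map_sub] using φ.le_opNorm (x - y)
  · rintro g ⟨⟨hg, -⟩, hgf⟩ hag
    refine le_antisymm (fun x => ?_) hag
    have hg₀ : g x₀ ≤ φ x₀ + c := by
      exact_mod_cast (hgf x₀).trans hsupp.ge
    -- compare with the reflection of `x` through `x₀`
    have hmid := hg.2 (Set.mem_univ x) (Set.mem_univ ((2 : ℝ) • x₀ - x))
      (show (0 : ℝ) ≤ 1 / 2 by norm_num) (show (0 : ℝ) ≤ 1 / 2 by norm_num) (by norm_num)
    rw [show (1 / 2 : ℝ) • x + (1 / 2 : ℝ) • ((2 : ℝ) • x₀ - x) = x₀ by module] at hmid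
    have hrefl := hag ((2 : ℝ) • x₀ - x)
    simp only [map_sub, map_smul, smul_eq_mul] at hmid hrefl ⊢
    linarith
end

section
/- Let X be a complete real normed vector space (a real Banach space) and let f : X → ℝ ∪ {−∞, +∞} be LĈ-convex. Then the set of points at which f is LĈ-subdifferentiable is dense in dom f: for every x̄ ∈ dom f and every δ > 0 there exists a point x_δ ∈ dom f with ‖x_δ − x̄‖ ≤ δ such that f is LĈ-subdifferentiable at x_δ. -/
open Filter Topology

/-- One step of the Ekeland construction: below any point of `A` there is a point of `A`
whose height is within `ε` of the infimum of the heights below it. -/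
lemma exists_almost_minimal_below {X : Type*} [PseudoMetricSpace X] {A : Set (X × ℝ)}
    (hA : ∀ p ∈ A, 0 ≤ p.2) {c : ℝ} (hc : 0 ≤ c) {p : X × ℝ} (hp : p ∈ A)
    {ε : ℝ} (hε : 0 < ε) :
    ∃ p' ∈ A, c * dist p'.1 p.1 ≤ p.2 - p'.2 ∧
      ∀ q ∈ A, c * dist q.1 p'.1 ≤ p'.2 - q.2 → p'.2 - ε ≤ q.2 := by
  set B : Set ℝ := Prod.snd '' {q ∈ A | c * dist q.1 p.1 ≤ p.2 - q.2}
  have hne : B.Nonempty := ⟨p.2, p, ⟨hp, by simp⟩, rfl⟩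
  have hbdd : BddBelow B := by
    refine ⟨0, ?_⟩
    rintro _ ⟨q, hq, rfl⟩
    exact hA q hq.1
  obtain ⟨_, ⟨p', ⟨hp'A, hp'⟩, rfl⟩, hlt⟩ := Real.lt_sInf_add_pos hne hε
  refine ⟨p', hp'A, hp', fun q hq hqp' => ?_⟩
  have hmem : q.2 ∈ B := by
    refine ⟨q, ⟨hq, ?_⟩, rfl⟩
    have := mul_le_mul_of_nonneg_left (dist_triangle q.1 p'.1 p.1) hc
    linarith
  linarith [csInf_le hbdd hmem]

/-- Ekeland's variational principle for a closed set `A ⊆ X × ℝ` of nonnegative heights. -/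
lemma exists_ekeland_point {X : Type*} [PseudoMetricSpace X] [CompleteSpace X]
    {A : Set (X × ℝ)} (hcl : IsClosed A) (hA : ∀ p ∈ A, 0 ≤ p.2) {c : ℝ} (hc : 0 < c)
    {p₀ : X × ℝ} (hp₀ : p₀ ∈ A) :
    ∃ p ∈ A, c * dist p.1 p₀.1 ≤ p₀.2 - p.2 ∧ ∀ q ∈ A, p.2 ≤ q.2 + c * dist q.1 p.1 := by
  have step : ∀ (n : ℕ) (p : A), ∃ p' : A, c * dist p'.1.1 p.1.1 ≤ p.1.2 - p'.1.2 ∧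
      ∀ q ∈ A, c * dist q.1 p'.1.1 ≤ p'.1.2 - q.2 → p'.1.2 - 1 / ((n : ℝ) + 1) ≤ q.2 := by
    intro n p
    obtain ⟨p', h, h'⟩ :=
      exists_almost_minimal_below hA hc.le p.2 (Nat.one_div_pos_of_nat (α := ℝ) (n := n))
    exact ⟨⟨p', h⟩, h'⟩
  choose next hnext hmin using step
  let u : ℕ → A := fun n => Nat.rec ⟨p₀, hp₀⟩ next n
  have hle : ∀ n k, c * dist (u (n + k)).1.1 (u n).1.1 ≤ (u n).1.2 - (u (n + k)).1.2 := by
    intro n k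
    induction k with
    | zero => simp
    | succ k ih =>
      have h1 : c * dist (u (n + (k + 1))).1.1 (u (n + k)).1.1
          ≤ (u (n + k)).1.2 - (u (n + (k + 1))).1.2 := hnext (n + k) (u (n + k))
      have := mul_le_mul_of_nonneg_left
        (dist_triangle (u (n + (k + 1))).1.1 (u (n + k)).1.1 (u n).1.1) hc.le
      linarith
  have hanti : Antitone fun n => (u n).1.2 := by
    intro n m hnm
    obtain ⟨k, rfl⟩ := Nat.exists_eq_add_of_le hnm
    have := hle n k
    have : 0 ≤ c * dist (u (n + k)).1.1 (u n).1.1 := by positivity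
    change (u (n + k)).1.2 ≤ (u n).1.2
    linarith
  have hbdd : BddBelow (Set.range fun n => (u n).1.2) := by
    refine ⟨0, ?_⟩
    rintro _ ⟨n, rfl⟩
    exact hA _ (u n).2
  have hs := tendsto_atTop_ciInf hanti hbdd
  set s := ⨅ n, (u n).1.2
  have hcauchy : CauchySeq fun n => (u n).1.1 := by
    refine cauchySeq_of_le_tendsto_0' (fun n => ((u n).1.2 - s) / c) (fun n m hnm => ?_) ?_
    · obtain ⟨k, rfl⟩ := Nat.exists_eq_add_of_le hnm
      rw [le_div_iff₀ hc, dist_comm, mul_comm]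
      have := hle n k
      have : s ≤ (u (n + k)).1.2 := ciInf_le hbdd (n + k)
      linarith
    · simpa using (hs.sub_const s).div_const c
  obtain ⟨x, hx⟩ := cauchySeq_tendsto_of_complete hcauchy
  have hlim : ∀ n, c * dist x (u n).1.1 ≤ (u n).1.2 - s := by
    intro n
    refine le_of_tendsto_of_tendsto ((hx.dist tendsto_const_nhds).const_mul c)
      (hs.const_sub _) ?_
    filter_upwards [eventually_ge_atTop n] with m hm
    obtain ⟨k, rfl⟩ := Nat.exists_eq_add_of_le hm
    exact hle n k
  refine ⟨(x, s), hcl.mem_of_tendsto (hx.prodMk_nhds hs) (Eventually.of_forall fun n => (u n).2),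
    hlim 0, fun q hq => ?_⟩
  by_contra! hlt
  have hqs : s ≤ q.2 := by
    have hs' : Tendsto (fun n : ℕ => (u (n + 1)).1.2 - 1 / ((n : ℝ) + 1)) atTop (𝓝 (s - 0)) :=
      (hs.comp (tendsto_add_atTop_nat 1)).sub tendsto_one_div_add_atTop_nhds_zero_nat
    rw [sub_zero] at hs'
    refine le_of_tendsto' hs' fun n => hmin n (u n) q hq ?_
    have h1 : c * dist x (u (n + 1)).1.1 ≤ (u (n + 1)).1.2 - s := hlim (n + 1)
    have h2 := mul_le_mul_of_nonneg_left (dist_triangle q.1 x (u (n + 1)).1.1) hc.le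
    change c * dist q.1 (u (n + 1)).1.1 ≤ (u (n + 1)).1.2 - q.2
    dsimp only at hlt
    linarith
  have : 0 ≤ c * dist q.1 x := by positivity
  dsimp only at hlt
  linarith

/-- If `X` is a real Banach space and `f : X → ℝ ∪ {−∞, +∞}` is `LĈ`-convex,
then the set of points at which `f` is `LĈ`-subdifferentiable is dense in `dom f`: for
every `x₀ ∈ dom f` and `δ > 0` there is `x₁ ∈ dom f` with `‖x₁ − x₀‖ ≤ δ` at which `f`
is `LĈ`-subdifferentiable. -/
theorem statement11 {X : Type*} [NormedAddCommGroup X] [NormedSpace ℝ X] [CompleteSpace X]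
    (f : X → EReal)
    (S : Set (X → ℝ))
    (hS : S = {h : X → ℝ | (ConcaveOn ℝ Set.univ h ∧
        ∃ k : ℝ, 0 ≤ k ∧ ∀ x y : X, |h x - h y| ≤ k * ‖x - y‖) ∧
        ∀ x, (h x : EReal) ≤ f x})
    (hconv : S.Nonempty ∧ ∀ x, f x = ⨆ h ∈ S, ((h x : ℝ) : EReal)) :
    ∀ x₀ : X, (f x₀ ≠ ⊤ ∧ f x₀ ≠ ⊥) → ∀ δ : ℝ, 0 < δ →
      ∃ x₁ : X, (f x₁ ≠ ⊤ ∧ f x₁ ≠ ⊥) ∧ ‖x₁ - x₀‖ ≤ δ ∧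
        ∃ h ∈ S, (h x₁ : EReal) = f x₁ := by
  obtain ⟨⟨h, hhS⟩, hsup⟩ := hconv
  have hfle : ∀ (x : X) (t : ℝ), f x ≤ t ↔ ∀ g ∈ S, g x ≤ t := by
    intro x t
    rw [hsup x]
    simp only [iSup_le_iff, EReal.coe_le_coe_iff]
  have hminor : ∀ g ∈ S, ∀ x, (g x : EReal) ≤ f x := by
    intro g hg
    rw [hS] at hg
    exact hg.2
  have hcont : ∀ g ∈ S, Continuous g := by
    intro g hg
    rw [hS] at hg
    obtain ⟨⟨-, k, -, hlip⟩, -⟩ := hg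
    refine (LipschitzWith.of_dist_le' (K := k) fun x y => ?_).continuous
    simpa [Real.dist_eq, dist_eq_norm] using hlip x y
  have hbot : ∀ x, f x ≠ ⊥ := fun x hx => by
    have := hminor h hhS x
    rw [hx] at this
    simp at this
  rintro x₀ ⟨hx₀, -⟩ δ hδ
  set A : Set (X × ℝ) := {p | ∀ g ∈ S, g p.1 - h p.1 ≤ p.2} with hAdef
  have hcl : IsClosed A := by
    simp only [hAdef, Set.ofPred_forall]
    refine isClosed_iInter fun g => isClosed_iInter fun hg => ?_
    exact isClosed_le (((hcont g hg).comp continuous_fst).sub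
      ((hcont h hhS).comp continuous_fst)) continuous_snd
  have hA : ∀ p ∈ A, 0 ≤ p.2 := fun p hp => by simpa using hp h hhS
  have hmemA : ∀ (x : X) (r : ℝ), f x = r → (x, r - h x) ∈ A := by
    intro x r hr g hg
    have := (hfle x r).1 hr.le g hg
    dsimp only
    linarith
  obtain ⟨r₀, hr₀⟩ : ∃ r : ℝ, f x₀ = r := ⟨_, (EReal.coe_toReal hx₀ (hbot x₀)).symm⟩
  have hp₀ := hmemA x₀ r₀ hr₀
  have hpos : 0 ≤ r₀ - h x₀ := hA _ hp₀
  set c := (r₀ - h x₀ + 1) / δ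
  have hc0 : 0 < c := by positivity
  obtain ⟨⟨x₁, s⟩, hpA, hdist, hek⟩ := exists_ekeland_point hcl hA hc0 hp₀
  have hs : 0 ≤ s := hA _ hpA
  dsimp only at hdist hek
  have hfx₁ : f x₁ ≤ ((h x₁ + s : ℝ) : EReal) := by
    rw [hfle]
    intro g hg
    have := hpA g hg
    dsimp only at this
    linarith
  have hkf : ∀ x, ((h x + s - c * ‖x - x₁‖ : ℝ) : EReal) ≤ f x := by
    intro x
    by_cases hx : f x = ⊤
    · simp [hx]
    obtain ⟨r, hr⟩ : ∃ r : ℝ, f x = r := ⟨_, (EReal.coe_toReal hx (hbot x)).symm⟩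
    have := hek _ (hmemA x r hr)
    rw [hr, EReal.coe_le_coe_iff]
    rw [dist_eq_norm] at this
    linarith
  refine ⟨x₁, ⟨fun htop => ?_, hbot x₁⟩, ?_, fun x => h x + s - c * ‖x - x₁‖, ?_, ?_⟩
  · rw [htop] at hfx₁
    exact EReal.coe_ne_top _ (top_le_iff.1 hfx₁)
  · have hcδ : c * δ = r₀ - h x₀ + 1 := div_mul_cancel₀ _ hδ.ne'
    rw [← dist_eq_norm]
    exact le_of_mul_le_mul_left (by linarith) hc0
  · rw [hS] at hhS ⊢
    obtain ⟨⟨hconc, k, hk, hlip⟩, -⟩ := hhS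
    refine ⟨⟨?_, k + c, by positivity, fun x y => ?_⟩, hkf⟩
    · have hnorm : ConvexOn ℝ Set.univ fun x => c * ‖x - x₁‖ := by
        simpa [dist_eq_norm] using (convexOn_univ_dist x₁).smul hc0.le
      exact (hconc.add_const s).sub hnorm
    · have h1 := abs_le.1 (hlip x y)
      have h2 := abs_le.1 (abs_norm_sub_norm_le (x - x₁) (y - x₁))
      rw [sub_sub_sub_cancel_right] at h2
      have h3 := mul_le_mul_of_nonneg_left h2.1 hc0.le
      have h4 := mul_le_mul_of_nonneg_left h2.2 hc0.le
      rw [abs_le]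
      constructor <;> dsimp only <;> linarith
  · refine le_antisymm (hkf x₁) ?_
    simpa using hfx₁
end

section
/- The function f : ℝ → ℝ given by f(x) = −√|x| is LĈ-convex (it is continuous and satisfies f(x) ≥ −|x| − 1 for all x, where x ↦ −|x| − 1 is Lipschitz continuous and concave), but f is not LĈ-subdifferentiable at the point 0: there is no constant k ≥ 0 with −√|x| ≥ −k·|x| for all x ∈ ℝ, equivalently no Lipschitz continuous concave h : ℝ → ℝ with h ≤ f and h(0) = 0. -/
theorem concaveOn_neg_mul_abs_sub {k : ℝ} (hk : 0 ≤ k) (c b : ℝ) :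
    ConcaveOn ℝ Set.univ fun x : ℝ => -(k * |x - c|) - b := by
  refine ⟨convex_univ, fun x _ y _ s t hs ht hst => ?_⟩
  simp only [smul_eq_mul]
  have hcomb : s * x + t * y - c = s * (x - c) + t * (y - c) := by
    linear_combination c * hst
  have habs : |s * x + t * y - c| ≤ s * |x - c| + t * |y - c| := by
    rw [hcomb]
    refine (abs_add_le _ _).trans_eq ?_
    rw [abs_mul, abs_mul, abs_of_nonneg hs, abs_of_nonneg ht]
  have hb : (s + t) * b = b := by rw [hst, one_mul]
  nlinarith [mul_le_mul_of_nonneg_left habs hk]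

theorem abs_neg_mul_abs_sub_sub_le {k : ℝ} (hk : 0 ≤ k) (c b x y : ℝ) :
    |(-(k * |x - c|) - b) - (-(k * |y - c|) - b)| ≤ k * ‖x - y‖ := by
  have hdiff : (-(k * |x - c|) - b) - (-(k * |y - c|) - b) = k * (|y - c| - |x - c|) := by ring
  rw [hdiff, abs_mul, abs_of_nonneg hk, Real.norm_eq_abs, abs_sub_comm x y]
  refine mul_le_mul_of_nonneg_left ((abs_abs_sub_abs_le _ _).trans_eq ?_) hk
  rw [sub_sub_sub_cancel_right]

theorem sqrt_abs_le_add_mul_abs_sub {ε : ℝ} (hε : 0 < ε) (c x : ℝ) :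
    √|x| ≤ √|c| + ε + 1 / (4 * ε) * |x - c| := by
  have htri : |x| ≤ |c| + |x - c| := by
    simpa using abs_add_le c (x - c)
  have hsq : √|x - c| ^ 2 = |x - c| := Real.sq_sqrt (abs_nonneg _)
  have hsub : √|x| ≤ √|c| + √|x - c| := by
    refine Real.sqrt_le_iff.mpr ⟨by positivity, ?_⟩
    nlinarith [Real.sq_sqrt (abs_nonneg c),
      mul_nonneg (Real.sqrt_nonneg |c|) (Real.sqrt_nonneg |x - c|)]
  have hyoung : √|x - c| ≤ ε + 1 / (4 * ε) * |x - c| := by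
    have hnonneg : 0 ≤ (√|x - c| - 2 * ε) ^ 2 / (4 * ε) := by positivity
    have hexpand : (√|x - c| - 2 * ε) ^ 2 / (4 * ε)
        = ε + 1 / (4 * ε) * √|x - c| ^ 2 - √|x - c| := by
      field_simp
      ring
    rw [hexpand, hsq] at hnonneg
    linarith
  linarith

theorem not_exists_neg_mul_abs_le_neg_sqrt_abs :
    ¬ ∃ k : ℝ, 0 ≤ k ∧ ∀ x : ℝ, -(k * |x|) ≤ -√|x| := by
  rintro ⟨k, hk, hle⟩
  have hpos : 0 < (k + 1)⁻¹ := by positivity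
  have h := hle ((k + 1)⁻¹ ^ 2)
  rw [abs_of_nonneg (sq_nonneg _), Real.sqrt_sq hpos.le] at h
  have hinv : (k + 1) * (k + 1)⁻¹ = 1 := mul_inv_cancel₀ (by positivity)
  nlinarith

/-- The function `f(x) = −√|x|` on `ℝ` is continuous, minorized by the
Lipschitz continuous concave function `x ↦ −|x| − 1`, and `LĈ`-convex, but `f` is not
`LĈ`-subdifferentiable at `0`: there is no `k ≥ 0` with `−√|x| ≥ −k·|x|` for all `x`,
equivalently no Lipschitz continuous concave `h : ℝ → ℝ` with `h ≤ f` and `h 0 = f 0`. -/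
theorem statement12 (f : ℝ → ℝ) (hf : f = fun x => -Real.sqrt |x|)
    (S : Set (ℝ → ℝ))
    (hS : S = {h : ℝ → ℝ | (ConcaveOn ℝ Set.univ h ∧
        ∃ k : ℝ, 0 ≤ k ∧ ∀ x y : ℝ, |h x - h y| ≤ k * ‖x - y‖) ∧
        ∀ x, h x ≤ f x}) :
    Continuous f ∧
    ((ConcaveOn ℝ Set.univ (fun x : ℝ => -|x| - 1) ∧
        ∃ k : ℝ, 0 ≤ k ∧ ∀ x y : ℝ, |(-|x| - 1) - (-|y| - 1)| ≤ k * ‖x - y‖) ∧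
      ∀ x : ℝ, -|x| - 1 ≤ f x) ∧
    (S.Nonempty ∧ ∀ x, (f x : EReal) = ⨆ h ∈ S, ((h x : ℝ) : EReal)) ∧
    (¬ ∃ k : ℝ, 0 ≤ k ∧ ∀ x : ℝ, -(k * |x|) ≤ f x) ∧
    (¬ ∃ h ∈ S, h 0 = f 0) := by
  have hmem : ∀ {ε : ℝ}, 0 < ε → ∀ c : ℝ,
      (fun x => -(1 / (4 * ε) * |x - c|) - (√|c| + ε)) ∈ S := by
    intro ε hε c
    have hk : 0 ≤ 1 / (4 * ε) := by positivity
    rw [hS, hf]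
    refine ⟨⟨concaveOn_neg_mul_abs_sub hk c _, _, hk,
      abs_neg_mul_abs_sub_sub_le hk c _⟩, fun x => ?_⟩
    have := sqrt_abs_le_add_mul_abs_sub hε c x
    dsimp only
    linarith
  have hnot : ¬ ∃ k : ℝ, 0 ≤ k ∧ ∀ x : ℝ, -(k * |x|) ≤ f x := by
    rw [hf]
    exact not_exists_neg_mul_abs_le_neg_sqrt_abs
  refine ⟨?_, ⟨⟨?_, 1, zero_le_one, fun x y => ?_⟩, fun x => ?_⟩,
    ⟨⟨_, hmem one_pos 0⟩, fun x => le_antisymm ?_ ?_⟩, hnot, ?_⟩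
  · rw [hf]
    fun_prop
  · simpa using concaveOn_neg_mul_abs_sub zero_le_one 0 1
  · simpa using abs_neg_mul_abs_sub_sub_le zero_le_one 0 1 x y
  · have := sqrt_abs_le_add_mul_abs_sub one_pos 0 x
    simp only [abs_zero, Real.sqrt_zero, sub_zero] at this
    rw [hf]
    dsimp only
    linarith [abs_nonneg x]
  · refine EReal.ge_of_forall_gt_iff_ge.mp fun r hr => ?_
    have hε : 0 < f x - r := sub_pos.mpr (EReal.coe_lt_coe_iff.mp hr)
    refine le_iSup₂_of_le _ (hmem hε x) (EReal.coe_le_coe ?_)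
    simp [hf]
  · refine iSup₂_le fun h hh => ?_
    rw [hS] at hh
    exact EReal.coe_le_coe (hh.2 x)
  · rintro ⟨h, hh, h0⟩
    rw [hS] at hh
    obtain ⟨⟨-, k, hk, hlip⟩, hle⟩ := hh
    refine hnot ⟨k, hk, fun x => le_trans ?_ (hle x)⟩
    have hx := neg_le_of_abs_le (hlip x 0)
    have hzero : h 0 = 0 := by simp [h0, hf]
    rw [hzero, sub_zero, sub_zero, Real.norm_eq_abs] at hx
    exact hx
end

section
/- Let X be a real normed space, let f : X → ℝ ∪ {+∞} be proper, lower semicontinuous and convex, and let x̄ ∈ dom f. Then the thin LĈ_θ-subdifferential of f at x̄ coincides with the Fenchel–Rockafellar subdifferential of f at x̄: a function l belongs to ∂_{LĈθ}f(x̄) if and only if l is (given by) a continuous linear functional x* on X satisfying f(x) − f(x̄) ≥ x*(x − x̄) for all x ∈ X. In particular, every maximal LĈ_θ-subgradient of f at x̄ is a continuous linear function. -/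
/-- A continuous concave function vanishing at the origin that lies below a convex subset of `X × ℝ`
through the origin is separated from it by a continuous linear functional. -/
theorem ConcaveOn.exists_continuousLinearMap_between {X : Type*} [NormedAddCommGroup X]
    [NormedSpace ℝ X] {l : X → ℝ} (hl : ConcaveOn ℝ Set.univ l) (hcont : Continuous l)
    (hl0 : l 0 = 0) {E : Set (X × ℝ)} (hE : Convex ℝ E) (h0 : (0, 0) ∈ E)
    (hle : ∀ p ∈ E, l p.1 ≤ p.2) :
    ∃ φ : X →L[ℝ] ℝ, (∀ x, l x ≤ φ x) ∧ ∀ p ∈ E, φ p.1 ≤ p.2 := by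
  have hconv : Convex ℝ {p : X × ℝ | p.2 < l p.1} := by
    simpa using hl.convex_strict_hypograph
  have hopen : IsOpen {p : X × ℝ | p.2 < l p.1} :=
    isOpen_lt continuous_snd (hcont.comp continuous_fst)
  have hdisj : Disjoint {p : X × ℝ | p.2 < l p.1} E :=
    Set.disjoint_left.2 fun p hp hpE => (hle p hpE).not_gt hp
  obtain ⟨F, u, hFu, huF⟩ := geometric_hahn_banach_open hconv hopen hE hdisj
  set c : ℝ := F (0, 1)
  have hF : ∀ (x : X) (r : ℝ), F (x, r) = F (x, 0) + r * c := by
    intro x r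
    have h : ((x, r) : X × ℝ) = (x, 0) + r • (0, 1) := by simp
    rw [h, map_add, map_smul, smul_eq_mul]
  have hF0 : F ((0 : X), (0 : ℝ)) = 0 := map_zero F
  have hu0 : u ≤ 0 := by simpa only [hF0] using huF (0, 0) h0
  have hneg : ∀ r : ℝ, r < 0 → r * c < u := by
    intro r hr
    have h := hFu (0, r) (by simpa [hl0] using hr)
    rwa [hF, hF0, zero_add] at h
  have hcpos : 0 < c := by linarith [hneg (-1) (by norm_num)]
  have hu : u = 0 := by
    refine le_antisymm hu0 (le_of_not_gt fun h => ?_)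
    have h' := hneg (u / c) (div_neg_of_neg_of_pos h hcpos)
    rw [div_mul_cancel₀ _ hcpos.ne'] at h'
    exact lt_irrefl _ h'
  subst hu
  refine ⟨-(c⁻¹ • F.comp (ContinuousLinearMap.inl ℝ X ℝ)), fun x => ?_, fun p hp => ?_⟩
  · refine le_of_forall_lt fun r hr => ?_
    have h := hFu (x, r) hr
    rw [hF] at h
    simp only [neg_apply, smul_apply,
      ContinuousLinearMap.comp_apply, ContinuousLinearMap.inl_apply, smul_eq_mul]
    rw [← mul_neg, inv_mul_eq_div, lt_div_iff₀ hcpos]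
    linarith
  · have h := huF (p.1, p.2) hp
    rw [hF] at h
    simp only [neg_apply, smul_apply,
      ContinuousLinearMap.comp_apply, ContinuousLinearMap.inl_apply, smul_eq_mul]
    rw [← mul_neg, inv_mul_eq_div, div_le_iff₀ hcpos]
    linarith

/-- A linear functional is maximal among concave functions vanishing at the origin. -/
theorem ConcaveOn.eq_of_linearMap_le {X : Type*} [AddCommGroup X] [Module ℝ X] {m : X → ℝ}
    (hm : ConcaveOn ℝ Set.univ m) (hm0 : m 0 = 0) (φ : X →ₗ[ℝ] ℝ) (h : ∀ x, φ x ≤ m x) :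
    m = φ := by
  funext x
  refine le_antisymm ?_ (h x)
  have hmid := hm.2 (Set.mem_univ x) (Set.mem_univ (-x))
    (one_half_pos (α := ℝ)).le (one_half_pos (α := ℝ)).le (add_halves 1)
  have hneg := h (-x)
  simp only [smul_neg, add_neg_cancel, hm0, smul_eq_mul] at hmid
  rw [map_neg] at hneg
  linarith


/-- For a proper lower semicontinuous convex `f : X → ℝ ∪ {+∞}` and
`x₀ ∈ dom f`, the thin `LĈ_θ`-subdifferential of `f` at `x₀` coincides with the
Fenchel–Rockafellar subdifferential: `l ∈ ∂_{LĈθ}f(x₀)` iff `l` is given by a continuous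
linear functional `x*` with `f(x) − f(x₀) ≥ x*(x − x₀)` for all `x`. In particular every
maximal `LĈ_θ`-subgradient of `f` at `x₀` is a continuous linear function. -/
theorem statement14 {X : Type*} [NormedAddCommGroup X] [NormedSpace ℝ X]
    (f : X → EReal) (hf_nebot : ∀ x, f x ≠ ⊥) (hf_proper : ∃ x, f x ≠ ⊤)
    (hlsc : LowerSemicontinuous f)
    (hconv : ∀ (x y : X) (a b : ℝ), 0 < a → 0 < b → a + b = 1 →
      f (a • x + b • y) ≤ (a : EReal) * f x + (b : EReal) * f y)
    (x₀ : X) (hx₀ : f x₀ ≠ ⊤)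
    (D : Set (X → ℝ))
    (hD : D = {l : X → ℝ | (ConcaveOn ℝ Set.univ l ∧
        ∃ k : ℝ, 0 ≤ k ∧ ∀ x y : X, |l x - l y| ≤ k * ‖x - y‖) ∧ l 0 = 0 ∧
        ∀ x, (l (x - x₀) : EReal) + f x₀ ≤ f x})
    (P : Set (X → ℝ)) (hP : P = {l ∈ D | ∀ m ∈ D, l ≤ m → m = l}) :
    (∀ l : X → ℝ, l ∈ P ↔ ∃ φ : X →L[ℝ] ℝ, l = ⇑φ ∧
      ∀ x, ((φ (x - x₀) : ℝ) : EReal) + f x₀ ≤ f x) ∧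
    (∀ l ∈ P, ∃ φ : X →L[ℝ] ℝ, l = ⇑φ) := by
  suffices main : ∀ l : X → ℝ, l ∈ P ↔ ∃ φ : X →L[ℝ] ℝ, l = ⇑φ ∧
      ∀ x, ((φ (x - x₀) : ℝ) : EReal) + f x₀ ≤ f x from
    ⟨main, fun l hl => ((main l).1 hl).imp fun _ h => h.1⟩
  subst hD hP
  obtain ⟨c, hc⟩ : ∃ c : ℝ, f x₀ = c :=
    ⟨(f x₀).toReal, (EReal.coe_toReal hx₀ (hf_nebot x₀)).symm⟩
  have hlin : ∀ φ : X →L[ℝ] ℝ, ConcaveOn ℝ Set.univ φ ∧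
      ∃ k : ℝ, 0 ≤ k ∧ ∀ x y : X, |φ x - φ y| ≤ k * ‖x - y‖ := fun φ =>
    ⟨φ.toLinearMap.concaveOn convex_univ, ‖φ‖, norm_nonneg φ, fun x y => by
      rw [← map_sub]
      exact φ.le_opNorm (x - y)⟩
  intro l
  constructor
  · rintro ⟨⟨⟨hl, k, hk, hlip⟩, hl0, hlf⟩, hmax⟩
    have hcont : Continuous l := by
      refine (LipschitzWith.of_dist_le_mul (K := ⟨k, hk⟩) fun x y => ?_).continuous
      rw [Real.dist_eq, dist_eq_norm]
      exact hlip x y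
    have hE : Convex ℝ {p : X × ℝ | f (x₀ + p.1) ≤ ((p.2 + c : ℝ) : EReal)} := by
      rw [convex_iff_forall_pos]
      intro p hp q hq a b ha hb hab
      have hpt : x₀ + (a • p + b • q).1 = a • (x₀ + p.1) + b • (x₀ + q.1) := by
        have h : x₀ = a • x₀ + b • x₀ := by rw [← add_smul, hab, one_smul]
        simp only [Prod.fst_add, Prod.smul_fst, smul_add]
        nth_rewrite 1 [h]
        abel
      have hval : (a • p + b • q).2 + c = a * (p.2 + c) + b * (q.2 + c) := by
        simp only [Prod.snd_add, Prod.smul_snd, smul_eq_mul]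
        linear_combination (-c) * hab
      rw [Set.mem_ofPred_eq, hpt, hval]
      refine (hconv _ _ a b ha hb hab).trans ?_
      push_cast
      rw [← EReal.coe_add, ← EReal.coe_add]
      exact add_le_add (mul_le_mul_of_nonneg_left hp (EReal.coe_nonneg.2 ha.le))
        (mul_le_mul_of_nonneg_left hq (EReal.coe_nonneg.2 hb.le))
    obtain ⟨φ, hlφ, hφE⟩ := hl.exists_continuousLinearMap_between hcont hl0 hE
      (by simp [hc]) (fun p hp => by
        have h := (hlf (x₀ + p.1)).trans hp
        rw [add_sub_cancel_left, hc, ← EReal.coe_add, EReal.coe_le_coe_iff] at h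
        linarith)
    have hφf : ∀ x, ((φ (x - x₀) : ℝ) : EReal) + f x₀ ≤ f x := by
      intro x
      rcases eq_or_ne (f x) ⊤ with hx | hx
      · rw [hx]
        exact le_top
      · have hfx := EReal.coe_toReal hx (hf_nebot x)
        have h := hφE (x - x₀, (f x).toReal - c) (by
          rw [Set.mem_ofPred_eq, add_sub_cancel, sub_add_cancel, hfx])
        rw [← hfx, hc, ← EReal.coe_add, EReal.coe_le_coe_iff]
        simp only at h
        linarith
    exact ⟨φ, (hmax φ ⟨hlin φ, map_zero φ, hφf⟩ hlφ).symm, hφf⟩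
  · rintro ⟨φ, rfl, hφf⟩
    exact ⟨⟨hlin φ, map_zero φ, hφf⟩, fun m hm hle =>
      hm.1.1.eq_of_linearMap_le hm.2.1 φ.toLinearMap hle⟩
end

section
/- Let X be a real normed space, f : X → ℝ ∪ {−∞, +∞}, and x̄ ∈ dom f, and suppose f is LĈ-subdifferentiable at x̄. Then f attains its global minimum over X at x̄ (f(x) ≥ f(x̄) for all x ∈ X) if and only if the identically zero function on X belongs to the thin LĈ_θ-subdifferential ∂_{LĈθ}f(x̄). -/
/-- A nonnegative concave function on a real vector space that vanishes at the origin is zero. -/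
theorem ConcaveOn.eq_zero_of_nonneg {E : Type*} [AddCommGroup E] [Module ℝ E] {m : E → ℝ}
    (hm : ConcaveOn ℝ Set.univ m) (hm_zero : m 0 = 0) (hm_nonneg : 0 ≤ m) : m = 0 := by
  funext x
  have hmid := hm.2 (Set.mem_univ x) (Set.mem_univ (-x))
    (by norm_num : (0 : ℝ) ≤ 1 / 2) (by norm_num : (0 : ℝ) ≤ 1 / 2) (by norm_num)
  rw [smul_neg, add_neg_cancel, hm_zero, smul_eq_mul, smul_eq_mul] at hmid
  have hx : 0 ≤ m x := hm_nonneg x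
  have hneg : 0 ≤ m (-x) := hm_nonneg (-x)
  show m x = 0
  linarith

/-- If `f : X → ℝ ∪ {−∞, +∞}` is `LĈ`-subdifferentiable at `x₀ ∈ dom f`,
then `f` attains its global minimum over `X` at `x₀` iff the identically zero function
belongs to the thin `LĈ_θ`-subdifferential `∂_{LĈθ}f(x₀)`. -/
theorem statement18 {X : Type*} [NormedAddCommGroup X] [NormedSpace ℝ X]
    (f : X → EReal) (x₀ : X) (hx₀ : f x₀ ≠ ⊤ ∧ f x₀ ≠ ⊥)
    (LC : Set (X → ℝ))
    (hLC : LC = {h : X → ℝ | ConcaveOn ℝ Set.univ h ∧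
        ∃ k : ℝ, 0 ≤ k ∧ ∀ x y : X, |h x - h y| ≤ k * ‖x - y‖})
    (hsub : ∃ h ∈ LC, (∀ x, (h x : EReal) ≤ f x) ∧ (h x₀ : EReal) = f x₀)
    (D : Set (X → ℝ))
    (hD : D = {l : X → ℝ | l ∈ LC ∧ l 0 = 0 ∧
        ∀ x, (l (x - x₀) : EReal) + f x₀ ≤ f x})
    (P : Set (X → ℝ)) (hP : P = {l ∈ D | ∀ m ∈ D, l ≤ m → m = l}) :
    (∀ x, f x₀ ≤ f x) ↔ (fun _ : X => (0 : ℝ)) ∈ P := by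
  subst hP hD hLC
  constructor
  · intro hmin
    refine ⟨⟨⟨concaveOn_const 0 convex_univ, 0, le_rfl, fun x y => by simp⟩, rfl,
      fun x => by simpa using hmin x⟩, ?_⟩
    rintro m ⟨⟨hm, -⟩, hm_zero, -⟩ hm_nonneg
    exact hm.eq_zero_of_nonneg hm_zero hm_nonneg
  · rintro ⟨⟨-, -, hle⟩, -⟩ x
    simpa using hle x
end
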